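/- Let f: ℚ⁵ → ℚ be given by the quartic ψ₁ above and suppose P = (1,1,0,0,0) is a triple point of the projective quartic threefold {ψ₁ = 0} ⊂ ℙ⁴. Then the rational points on {ψ₁ = 0} are dense (in the Euclidean topology on the real points near P): for every line ℓ through P not contained in the tangent cone, ψ₁ restricted to ℓ is a quartic with a triple root at P, hence has exactly one further root, which is rational if ℓ is rational; varying ℓ over rational lines yields a dense set of rational points of {ψ₁=0}. -/

import Mathlib

open MvPolynomial

/-- The quartic `ψ₁` in variables `m = X 0`, `α₁ = X 1`, …, `α₄ = X 4`. -/
noncomputable def psi1 : MvPolynomial (Fin 5) ℚ :=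
  (2 * X 1 - X 2 - X 3 - X 4) * ((X 0) ^ 3 - 3 * (X 1) ^ 2 * X 0)
    - (2 * (X 1) ^ 2 - (X 2) ^ 2 - (X 3) ^ 2 - (X 4) ^ 2)
        * (3 * (X 0) ^ 2 - 3 * X 1 * X 0)
    + (2 * (X 1) ^ 3 - (X 2) ^ 3 - (X 3) ^ 3 - (X 4) ^ 3)
        * (3 * X 0 - X 1 - X 2 - X 3 - X 4)

/-- The coefficient of `m` in `ψ₁(m, m + u, b, c, d)`, which is linear in `m`. -/
def psi1Slope (u b c d : ℝ) : ℝ :=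
  -(2 * u ^ 3 + 3 * u ^ 2 * (b + c + d) + 3 * u * (b ^ 2 + c ^ 2 + d ^ 2)
    + 2 * (b ^ 3 + c ^ 3 + d ^ 3))

/-- The constant coefficient of `ψ₁(m, m + u, b, c, d)` as a polynomial in `m`. -/
def psi1Const (u b c d : ℝ) : ℝ :=
  (b ^ 3 + c ^ 3 + d ^ 3 - 2 * u ^ 3) * (u + (b + c + d))

/-- The real zeros of `ψ₁`. -/
def psi1RealZeros : Set (Fin 5 → ℝ) :=
  {x | eval x (psi1.map (algebraMap ℚ ℝ)) = 0}

/-- The real zeros of `ψ₁` all of whose coordinates are rational. -/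
def psi1RatZeros : Set (Fin 5 → ℝ) :=
  {x | eval x (psi1.map (algebraMap ℚ ℝ)) = 0 ∧ ∀ i, ∃ q : ℚ, x i = (q : ℝ)}

theorem eval_map_psi1 (x : Fin 5 → ℝ) :
    eval x (psi1.map (algebraMap ℚ ℝ)) =
      x 0 * psi1Slope (x 1 - x 0) (x 2) (x 3) (x 4)
        + psi1Const (x 1 - x 0) (x 2) (x 3) (x 4) := by
  simp only [psi1, psi1Slope, psi1Const, map_add, map_sub, map_mul, map_pow, map_X,
    eval_X, map_ofNat]
  ring

theorem dense_setOf_forall_rat (n : ℕ) :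
    Dense {w : Fin n → ℝ | ∀ i, ∃ q : ℚ, w i = (q : ℝ)} := by
  have h : {w : Fin n → ℝ | ∀ i, ∃ q : ℚ, w i = (q : ℝ)} =
      Set.univ.pi fun _ => Set.range ((↑) : ℚ → ℝ) := by
    ext w
    simp [eq_comm]
  rw [h]
  exact dense_pi _ fun _ _ => Rat.denseRange_cast

/-- Where the slope does not vanish, projection from the triple point is inverted by
a rational map, so rational points are dense there. -/
theorem mem_closure_psi1RatZeros_of_slope_ne_zero {u b c d : ℝ}
    (h : psi1Slope u b c d ≠ 0) :
    ![-psi1Const u b c d / psi1Slope u b c d,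
      -psi1Const u b c d / psi1Slope u b c d + u, b, c, d] ∈ closure psi1RatZeros := by
  let s : (Fin 4 → ℝ) → ℝ := fun w => psi1Slope (w 0) (w 1) (w 2) (w 3)
  let k : (Fin 4 → ℝ) → ℝ := fun w => psi1Const (w 0) (w 1) (w 2) (w 3)
  let g : (Fin 4 → ℝ) → Fin 5 → ℝ := fun w =>
    ![-k w / s w, -k w / s w + w 0, w 1, w 2, w 3]
  have hs : Continuous s := by unfold s psi1Slope; fun_prop
  have hk : Continuous k := by unfold k psi1Const; fun_prop
  have hopen : IsOpen {w | s w ≠ 0} := isOpen_ne_fun hs continuous_const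
  have hw : s ![u, b, c, d] ≠ 0 := h
  have hcl := (dense_setOf_forall_rat 4).open_subset_closure_inter hopen hw
  have hq : ContinuousAt (fun w => -k w / s w) ![u, b, c, d] :=
    hk.neg.continuousAt.div hs.continuousAt hw
  have hg : ContinuousAt g ![u, b, c, d] := by
    rw [continuousAt_pi]
    intro i
    fin_cases i
    · exact hq
    · exact hq.add (continuous_apply 0).continuousAt
    · exact (continuous_apply 1).continuousAt
    · exact (continuous_apply 2).continuousAt
    · exact (continuous_apply 3).continuousAt
  refine hg.continuousWithinAt.mem_closure hcl ?_
  rintro w ⟨hw0, hwq⟩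
  have hw0 : s w ≠ 0 := hw0
  refine ⟨?_, ?_⟩
  · rw [eval_map_psi1]
    change -k w / s w * psi1Slope (-k w / s w + w 0 - -k w / s w) (w 1) (w 2) (w 3)
      + psi1Const (-k w / s w + w 0 - -k w / s w) (w 1) (w 2) (w 3) = 0
    rw [add_sub_cancel_left]
    change -k w / s w * s w + k w = 0
    field_simp
    ring
  · choose q hq using hwq
    let r : ℚ := -((q 1 ^ 3 + q 2 ^ 3 + q 3 ^ 3 - 2 * q 0 ^ 3) * (q 0 + (q 1 + q 2 + q 3))) /
      -(2 * q 0 ^ 3 + 3 * q 0 ^ 2 * (q 1 + q 2 + q 3) + 3 * q 0 * (q 1 ^ 2 + q 2 ^ 2 + q 3 ^ 2)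
        + 2 * (q 1 ^ 3 + q 2 ^ 3 + q 3 ^ 3))
    have hr : -k w / s w = (r : ℝ) := by
      simp only [k, s, r, psi1Const, psi1Slope, hq]
      push_cast
      rfl
    intro i
    fin_cases i
    · exact ⟨r, hr⟩
    · refine ⟨r + q 0, ?_⟩
      change -k w / s w + w 0 = _
      rw [hr, hq]
      push_cast
      rfl
    · exact ⟨q 1, hq 1⟩
    · exact ⟨q 2, hq 2⟩
    · exact ⟨q 3, hq 3⟩

theorem mem_closure_psi1RatZeros_of_mul_eq_zero (m : ℝ) {b c d : ℝ} (h : b * c * d = 0) :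
    ![m, m - (b + c + d), b, c, d] ∈ closure psi1RatZeros := by
  have key (g : (Fin 3 → ℝ) → Fin 3 → ℝ) (hg : Continuous g)
      (hz : ∀ w, g w 0 * g w 1 * g w 2 = 0)
      (hr : ∀ w : Fin 3 → ℝ, (∀ i, ∃ q : ℚ, w i = (q : ℝ)) → ∀ i, ∃ q : ℚ, g w i = (q : ℝ))
      (w : Fin 3 → ℝ) :
      ![w 0, w 0 - (g w 0 + g w 1 + g w 2), g w 0, g w 1, g w 2] ∈ closure psi1RatZeros := by
    have hgi (i : Fin 3) : Continuous fun w => g w i := (continuous_apply i).comp hg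
    have hcont : Continuous fun w : Fin 3 → ℝ =>
        ![w 0, w 0 - (g w 0 + g w 1 + g w 2), g w 0, g w 1, g w 2] := by
      refine continuous_pi fun i => ?_
      fin_cases i
      · exact continuous_apply 0
      · exact (continuous_apply 0).sub (((hgi 0).add (hgi 1)).add (hgi 2))
      · exact hgi 0
      · exact hgi 1
      · exact hgi 2
    refine hcont.continuousWithinAt.mem_closure (dense_setOf_forall_rat 3 w) ?_
    intro v hv
    refine ⟨?_, ?_⟩
    · rw [eval_map_psi1]
      change v 0 * psi1Slope (v 0 - (g v 0 + g v 1 + g v 2) - v 0) (g v 0) (g v 1) (g v 2)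
        + psi1Const (v 0 - (g v 0 + g v 1 + g v 2) - v 0) (g v 0) (g v 1) (g v 2) = 0
      unfold psi1Slope psi1Const
      linear_combination -6 * v 0 * hz v
    · choose q hq using hr v hv
      obtain ⟨p, hp⟩ := hv 0
      intro i
      fin_cases i
      · exact ⟨p, hp⟩
      · refine ⟨p - (q 0 + q 1 + q 2), ?_⟩
        change v 0 - (g v 0 + g v 1 + g v 2) = _
        rw [hp, hq, hq, hq]
        push_cast
        rfl
      · exact ⟨q 0, hq 0⟩
      · exact ⟨q 1, hq 1⟩
      · exact ⟨q 2, hq 2⟩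
  have h0 : ∃ q : ℚ, (0 : ℝ) = (q : ℝ) := ⟨0, by simp⟩
  rcases mul_eq_zero.mp h with h | rfl
  · rcases mul_eq_zero.mp h with rfl | rfl
    · refine key (fun w => ![0, w 1, w 2]) (by fun_prop) (by simp) ?_ ![m, c, d]
      intro w hw i
      fin_cases i
      exacts [h0, hw 1, hw 2]
    · refine key (fun w => ![w 1, 0, w 2]) (by fun_prop) (by simp) ?_ ![m, b, d]
      intro w hw i
      fin_cases i
      exacts [hw 1, h0, hw 2]
  · refine key (fun w => ![w 1, w 2, 0]) (by fun_prop) (by simp) ?_ ![m, b, c]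
    intro w hw i
    fin_cases i
    exacts [hw 1, hw 2, h0]

/-- Points over the Fermat cubic `b³ + c³ + d³ = 0` in `u = 0` are limits of zeros with
nonvanishing slope, along the curve `s ↦ ((p / m - 2) s, b + s, c + s, d + s)`
with `p = b + c + d`. -/
theorem mem_closure_psi1RatZeros_of_sum_cubes {m b c d : ℝ} (hm : m ≠ 0)
    (hp : b + c + d ≠ 0) (h : b ^ 3 + c ^ 3 + d ^ 3 = 0) :
    ![m, m, b, c, d] ∈ closure psi1RatZeros := by
  have hp2 : b ^ 2 + c ^ 2 + d ^ 2 ≠ 0 := by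
    intro h0
    have hb : b = 0 := by nlinarith [sq_nonneg b, sq_nonneg c, sq_nonneg d]
    have hc : c = 0 := by nlinarith [sq_nonneg b, sq_nonneg c, sq_nonneg d]
    have hd : d = 0 := by nlinarith [sq_nonneg b, sq_nonneg c, sq_nonneg d]
    simp [hb, hc, hd] at hp
  let j : ℝ := (b + c + d) / m - 2
  let t : ℝ → ℝ := fun s => 3 * (b ^ 2 + c ^ 2 + d ^ 2) + 3 * (b + c + d) * s + 3 * s ^ 2
  let sl : ℝ → ℝ := fun s =>
    -(2 * j ^ 3 * s ^ 2 + 3 * j ^ 2 * s * (b + c + d + 3 * s)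
      + 3 * j * ((b + s) ^ 2 + (c + s) ^ 2 + (d + s) ^ 2) + 2 * t s)
  let k : ℝ → ℝ := fun s => (t s - 2 * j ^ 3 * s ^ 2) * (j * s + (b + c + d + 3 * s))
  have hsl (s : ℝ) : psi1Slope (j * s) (b + s) (c + s) (d + s) = s * sl s := by
    simp only [psi1Slope, sl, t]
    linear_combination -2 * h
  have hk (s : ℝ) : psi1Const (j * s) (b + s) (c + s) (d + s) = s * k s := by
    simp only [psi1Const, k, t]
    linear_combination (j * s + (b + c + d + 3 * s)) * h
  have hsl0 : sl 0 = -(3 * (b ^ 2 + c ^ 2 + d ^ 2) * (b + c + d) / m) := by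
    simp only [sl, t, j]
    field_simp
    ring
  have hsl0' : sl 0 ≠ 0 := by
    rw [hsl0]
    exact neg_ne_zero.mpr (div_ne_zero (mul_ne_zero (mul_ne_zero three_ne_zero hp2) hp) hm)
  have hk0 : -k 0 / sl 0 = m := by
    rw [hsl0]
    simp only [k, t]
    field_simp
    ring
  have hslc : Continuous sl := by unfold sl t; fun_prop
  have hkc : Continuous k := by unfold k t; fun_prop
  have hq : ContinuousAt (fun s => -k s / sl s) 0 :=
    hkc.neg.continuousAt.div hslc.continuousAt hsl0'
  let g : ℝ → Fin 5 → ℝ := fun s => ![-k s / sl s, -k s / sl s + j * s, b + s, c + s, d + s]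
  have hg : ContinuousAt g 0 := by
    rw [continuousAt_pi]
    intro i
    fin_cases i
    · exact hq
    · exact hq.add (continuous_const.mul continuous_id).continuousAt
    · exact (continuous_const.add continuous_id).continuousAt
    · exact (continuous_const.add continuous_id).continuousAt
    · exact (continuous_const.add continuous_id).continuousAt
  have hg0 : g 0 = ![m, m, b, c, d] := by simp [g, hk0]
  have hcl : (0 : ℝ) ∈ closure ({0}ᶜ ∩ {s | sl s ≠ 0}) := by
    rw [Set.inter_comm]
    exact (dense_compl_singleton (0 : ℝ)).open_subset_closure_inter
      (isOpen_ne_fun hslc continuous_const) hsl0'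
  rw [← hg0, ← closure_closure]
  refine hg.continuousWithinAt.mem_closure hcl ?_
  rintro s ⟨hs, hss⟩
  have hs : s ≠ 0 := hs
  have hss : sl s ≠ 0 := hss
  have hmem := mem_closure_psi1RatZeros_of_slope_ne_zero (u := j * s) (b := b + s) (c := c + s)
    (d := d + s) (by rw [hsl]; exact mul_ne_zero hs hss)
  rwa [hsl, hk, ← mul_neg, mul_div_mul_left _ _ hs] at hmem

theorem psi1RealZeros_subset_closure : psi1RealZeros ⊆ closure psi1RatZeros := by
  intro x hx
  obtain ⟨m, u, b, c, d, rfl⟩ : ∃ m u b c d : ℝ, x = ![m, m + u, b, c, d] :=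
    ⟨x 0, x 1 - x 0, x 2, x 3, x 4, by ext i; fin_cases i <;> simp⟩
  have hx : m * psi1Slope u b c d + psi1Const u b c d = 0 := by
    have h := (eval_map_psi1 _).symm.trans hx
    change m * psi1Slope (m + u - m) b c d + psi1Const (m + u - m) b c d = 0 at h
    rwa [add_sub_cancel_left] at h
  by_cases hs : psi1Slope u b c d = 0
  swap
  · have hm : m = -psi1Const u b c d / psi1Slope u b c d := by
      rw [eq_div_iff hs]
      linarith
    have hmem := mem_closure_psi1RatZeros_of_slope_ne_zero hs
    rwa [← hm] at hmem
  by_cases hu : u + (b + c + d) = 0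
  · obtain rfl : u = -(b + c + d) := by linarith
    rw [← sub_eq_add_neg]
    apply mem_closure_psi1RatZeros_of_mul_eq_zero
    unfold psi1Slope at hs
    linear_combination (-1 / 6) * hs
  have hcubes : b ^ 3 + c ^ 3 + d ^ 3 - 2 * u ^ 3 = 0 := by
    rw [hs, mul_zero, zero_add] at hx
    exact (mul_eq_zero.mp hx).resolve_right hu
  obtain rfl : u = 0 := by
    have hprod : u * (2 * u ^ 2 + u * (b + c + d) + (b ^ 2 + c ^ 2 + d ^ 2)) = 0 := by
      unfold psi1Slope at hs
      linear_combination (-1 / 3) * hs - (2 / 3) * hcubes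
    rcases mul_eq_zero.mp hprod with h | h
    · exact h
    · nlinarith [sq_nonneg (b + u / 2), sq_nonneg (c + u / 2), sq_nonneg (d + u / 2),
        sq_nonneg u]
  have hp : b + c + d ≠ 0 := by simpa using hu
  have h3 : b ^ 3 + c ^ 3 + d ^ 3 = 0 := by simpa using hcubes
  have hg : Continuous fun n : ℝ => ![n, n, b, c, d] := by fun_prop
  rw [add_zero, ← closure_closure]
  refine hg.continuousWithinAt.mem_closure (dense_compl_singleton (0 : ℝ) m) ?_
  exact fun n hn => mem_closure_psi1RatZeros_of_sum_cubes hn hp h3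

/-- If `P = (1,1,0,0,0)` is a triple point of the quartic threefold
`{ψ₁ = 0}` (i.e. `ψ₁` and all its first and second partial derivatives vanish
at `P` while some third partial derivative does not), then the rational points
of `{ψ₁ = 0}` are dense, in the Euclidean topology, in its real points:
every real zero of `ψ₁` lies in the closure of the set of rational zeros. -/
theorem psi1_rational_points_dense
    (h0 : eval (![1, 1, 0, 0, 0] : Fin 5 → ℚ) psi1 = 0)
    (h1 : ∀ i : Fin 5, eval (![1, 1, 0, 0, 0] : Fin 5 → ℚ) (pderiv i psi1) = 0)
    (h2 : ∀ i j : Fin 5,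
      eval (![1, 1, 0, 0, 0] : Fin 5 → ℚ) (pderiv j (pderiv i psi1)) = 0)
    (h3 : ∃ i j k : Fin 5,
      eval (![1, 1, 0, 0, 0] : Fin 5 → ℚ) (pderiv k (pderiv j (pderiv i psi1))) ≠ 0) :
    {x : Fin 5 → ℝ | eval x (psi1.map (algebraMap ℚ ℝ)) = 0} ⊆
      closure {x : Fin 5 → ℝ | eval x (psi1.map (algebraMap ℚ ℝ)) = 0 ∧
        ∀ i, ∃ q : ℚ, x i = (q : ℝ)} := by
  exact psi1RealZeros_subset_closure
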